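/- arXiv:1505.00964 — 9 statements merged into one kernel-verified Lean document; each statement's English description precedes it below -/
import Mathlib

section
/- Let λ ∈ ℂ with Re(λ) > 0, let f₀(t) = exp(−λt²/2) ∈ 𝒮(ℝ, ℂ), and define fₙ = (D*)ⁿ f₀, where (D*f)(t) = −f′(t) + conj(λ)tf(t). Then for every natural number n, fₙ is a nonzero Schwartz function and satisfies the eigenvalue equation D*(D fₙ) = 2n·Re(λ)·fₙ, where (Df)(t) = f′(t) + λtf(t). Consequently every number 2n·Re(λ), n ∈ ℕ, is an eigenvalue of the harmonic oscillator H = D*D on 𝒮(ℝ). -/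
open Complex

open Polynomial in
lemma hasDerivAt_polynomial_mul_gaussian (l : ℂ) (P : ℂ[X]) (t : ℝ) :
    HasDerivAt (fun t : ℝ => P.eval (t : ℂ) * exp (-l * (t : ℂ) ^ 2 / 2))
      ((derivative P - C l * X * P).eval (t : ℂ) * exp (-l * (t : ℂ) ^ 2 / 2)) t := by
  have hexp : HasDerivAt (fun z : ℂ => exp (-l * z ^ 2 / 2))
      (exp (-l * (t : ℂ) ^ 2 / 2) * (-l * t)) t := by
    convert! ((((hasDerivAt_id (t : ℂ)).pow 2).const_mul (-l)).div_const 2).cexp using 1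
    simp only [id, Pi.pow_apply]
    push_cast
    ring
  convert! ((P.hasDerivAt (t : ℂ)).mul hexp).comp_ofReal using 1
  simp only [eval_sub, eval_mul, eval_C, eval_X]
  ring

open Polynomial in
lemma iteratedDeriv_gaussian (l : ℂ) (n : ℕ) :
    ∃ P : ℂ[X], iteratedDeriv n (fun t : ℝ => exp (-l * (t : ℂ) ^ 2 / 2)) =
      fun t : ℝ => P.eval (t : ℂ) * exp (-l * (t : ℂ) ^ 2 / 2) := by
  induction n with
  | zero => exact ⟨1, by simp⟩
  | succ n ih =>
    obtain ⟨P, hP⟩ := ih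
    refine ⟨derivative P - C l * X * P, ?_⟩
    rw [iteratedDeriv_succ, hP]
    exact funext fun t => (hasDerivAt_polynomial_mul_gaussian l P t).deriv

lemma norm_gaussian (l : ℂ) (t : ℝ) :
    ‖exp (-l * (t : ℂ) ^ 2 / 2)‖ = Real.exp (-(l.re / 2) * t ^ 2) := by
  have h : -l * (t : ℂ) ^ 2 / 2 = ((t ^ 2 / 2 : ℝ) : ℂ) * -l := by
    push_cast
    ring
  rw [norm_exp, h, re_ofReal_mul, neg_re]
  ring_nf

lemma exists_abs_pow_mul_gaussian_le {a : ℝ} (ha : 0 < a) (k : ℕ) :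
    ∃ B : ℝ, ∀ t : ℝ, |t| ^ k * Real.exp (-a * t ^ 2) ≤ B := by
  have hlim : Filter.Tendsto (fun t : ℝ => |t| ^ k * Real.exp (-a * t ^ 2))
      (Filter.cocompact ℝ) (nhds 0) := by
    simpa only [Real.rpow_natCast] using tendsto_rpow_abs_mul_exp_neg_mul_sq_cocompact ha (k : ℝ)
  have hcont : Continuous fun t : ℝ => |t| ^ k * Real.exp (-a * t ^ 2) := by fun_prop
  obtain ⟨B, hB⟩ := (ZeroAtInftyContinuousMap.isBounded_range
    (⟨⟨_, hcont⟩, hlim⟩ : ZeroAtInftyContinuousMap ℝ ℝ)).bddAbove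
  exact ⟨B, fun t => hB ⟨t, rfl⟩⟩

open Polynomial in
lemma exists_abs_pow_mul_polynomial_mul_gaussian_le {l : ℂ} (hl : 0 < l.re) (P : ℂ[X]) (k : ℕ) :
    ∃ B : ℝ, ∀ t : ℝ, |t| ^ k * ‖P.eval (t : ℂ) * exp (-l * (t : ℂ) ^ 2 / 2)‖ ≤ B := by
  induction P using Polynomial.induction_on' with
  | add P Q hP hQ =>
    obtain ⟨B, hB⟩ := hP
    obtain ⟨B', hB'⟩ := hQ
    refine ⟨B + B', fun t => le_trans ?_ (add_le_add (hB t) (hB' t))⟩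
    rw [eval_add, add_mul, ← mul_add]
    gcongr
    exact norm_add_le _ _
  | monomial m c =>
    obtain ⟨B, hB⟩ := exists_abs_pow_mul_gaussian_le (half_pos hl) (k + m)
    refine ⟨‖c‖ * B, fun t => le_trans (le_of_eq ?_) (mul_le_mul_of_nonneg_left (hB t)
      (norm_nonneg c))⟩
    rw [eval_monomial, norm_mul, norm_gaussian, norm_mul, norm_pow, norm_real, Real.norm_eq_abs]
    ring

/-- The complex Gaussian `t ↦ exp (-l t² / 2)` with `0 < re l`, as a Schwartz function. -/
noncomputable def gaussianSchwartz (l : ℂ) (hl : 0 < l.re) : SchwartzMap ℝ ℂ where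
  toFun t := exp (-l * (t : ℂ) ^ 2 / 2)
  smooth' := by
    have h : ContDiff ℝ ⊤ fun t : ℝ => (t : ℂ) := ofRealCLM.contDiff
    exact (((contDiff_const.mul (h.pow 2)).div_const 2).cexp).of_le le_top
  decay' k n := by
    obtain ⟨P, hP⟩ := iteratedDeriv_gaussian l n
    simpa only [norm_iteratedFDeriv_eq_norm_iteratedDeriv, hP, Real.norm_eq_abs] using
      exists_abs_pow_mul_polynomial_mul_gaussian_le hl P k

/-- The annihilation operator `f ↦ f' + l t f`. -/
noncomputable def annihilation (l : ℂ) (g : ℝ → ℂ) : ℝ → ℂ :=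
  fun t => deriv g t + l * (t : ℂ) * g t

/-- The operator `f ↦ -f' + c t f`; it is the creation operator when `c` is the conjugate of the
parameter of the annihilation operator. -/
noncomputable def creation (c : ℂ) (g : ℝ → ℂ) : ℝ → ℂ :=
  fun t => -deriv g t + c * (t : ℂ) * g t

lemma exists_schwartz_eq_creation (c : ℂ) (g : SchwartzMap ℝ ℂ) :
    ∃ h : SchwartzMap ℝ ℂ, ⇑h = creation c g := by
  refine ⟨-SchwartzMap.derivCLM ℂ ℂ g + c • SchwartzMap.smulLeftCLM ℂ Complex.ofReal g,
    funext fun t => ?_⟩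
  simp [creation, SchwartzMap.smulLeftCLM_apply_apply Function.Complex.hasTemperateGrowth_ofReal, mul_assoc]

lemma exists_schwartz_eq_iterate_creation (c : ℂ) (g : SchwartzMap ℝ ℂ) (n : ℕ) :
    ∃ h : SchwartzMap ℝ ℂ, ⇑h = (creation c)^[n] g := by
  induction n with
  | zero => exact ⟨g, rfl⟩
  | succ n ih =>
    obtain ⟨h, hh⟩ := ih
    rw [Function.iterate_succ_apply', ← hh]
    exact exists_schwartz_eq_creation c h

lemma creation_smul (c a : ℂ) (g : ℝ → ℂ) : creation c (a • g) = a • creation c g := by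
  funext t
  simp only [creation, deriv_const_smul_field, Pi.smul_apply, smul_eq_mul]
  ring

lemma annihilation_creation (l c : ℂ) {g : ℝ → ℂ} (hg : ContDiff ℝ 2 g) :
    annihilation l (creation c g) = creation c (annihilation l g) + (l + c) • g := by
  funext t
  have hg₁ : HasDerivAt g (deriv g t) t := (hg.differentiable (by norm_num) t).hasDerivAt
  have hg₂ : HasDerivAt (deriv g) (deriv (deriv g) t) t :=
    (hg.differentiable_deriv_two t).hasDerivAt
  have hmul (a : ℂ) : HasDerivAt (fun t : ℝ => a * (t : ℂ) * g t)
      (a * g t + a * t * deriv g t) t := by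
    convert! ((ofRealCLM.hasDerivAt (x := t)).const_mul a).mul hg₁ using 1
    simp
  have hcre : deriv (creation c g) t = _ := (hg₂.neg.add (hmul c)).deriv
  have hann : deriv (annihilation l g) t = _ := (hg₂.add (hmul l)).deriv
  rw [annihilation, Pi.add_apply, creation.eq_def c (annihilation l g), hcre, hann]
  simp only [annihilation, creation, Pi.smul_apply, smul_eq_mul]
  ring

lemma annihilation_gaussian (l : ℂ) :
    annihilation l (fun t : ℝ => exp (-l * (t : ℂ) ^ 2 / 2)) = 0 := by
  funext t
  have h := (hasDerivAt_polynomial_mul_gaussian l 1 t).deriv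
  simp only [Polynomial.eval_one, one_mul] at h
  rw [annihilation, h]
  simp

/-- The ladder argument: starting from a vacuum vector `g`, the iterates of the creation operator
are eigenfunctions of the number operator. -/
lemma creation_annihilation_iterate (l c : ℂ) (g : SchwartzMap ℝ ℂ) (hg : annihilation l g = 0)
    (n : ℕ) : creation c (annihilation l ((creation c)^[n] g)) =
      ((n : ℂ) * (l + c)) • (creation c)^[n] g := by
  induction n with
  | zero =>
    funext t
    simp [hg, creation]
  | succ n ih =>
    obtain ⟨h, hh⟩ := exists_schwartz_eq_iterate_creation c g n
    rw [← hh] at ih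
    rw [Function.iterate_succ_apply', ← hh, annihilation_creation l c (h.smooth 2), ih, ← add_smul, creation_smul]
    push_cast
    ring_nf

lemma iterate_creation_ne_zero {l c : ℂ} (hlc : l + c ≠ 0) (g : SchwartzMap ℝ ℂ)
    (hg : annihilation l g = 0) (hg₀ : ⇑g ≠ 0) (n : ℕ) : (creation c)^[n] g ≠ 0 := by
  induction n with
  | zero => exact hg₀
  | succ n ih =>
    intro h₀
    obtain ⟨h, hh⟩ := exists_schwartz_eq_iterate_creation c g n
    have hcomm := annihilation_creation l c (h.smooth 2)
    rw [hh, creation_annihilation_iterate l c g hg, ← Function.iterate_succ_apply' (creation c),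
      h₀, ← add_smul] at hcomm
    have hzero : annihilation l 0 = 0 := by
      funext t
      simp [annihilation]
    rw [hzero, eq_comm, smul_eq_zero, ← add_one_mul] at hcomm
    exact hcomm.elim (mul_ne_zero (Nat.cast_add_one_ne_zero n) hlc) ih

/-- For `λ ∈ ℂ` with `Re λ > 0`, `f₀(t) = exp(−λt²/2)` and `fₙ = (D*)ⁿ f₀`
(with `D f = f′ + λ t f`, `D* f = −f′ + conj(λ) t f`), every `fₙ` is a nonzero
Schwartz function satisfying the eigenvalue equation `D*(D fₙ) = 2n Re(λ) fₙ`;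
hence each `2n Re(λ)`, `n ∈ ℕ`, is an eigenvalue of the harmonic oscillator
`H = D*D` on Schwartz space. -/
theorem creation_operator_eigenfunctions (l : ℂ) (hl : 0 < l.re) (n : ℕ) :
    let D : (ℝ → ℂ) → (ℝ → ℂ) := fun g t => deriv g t + l * (t : ℂ) * g t
    let Dstar : (ℝ → ℂ) → (ℝ → ℂ) := fun g t => -deriv g t + (starRingEnd ℂ) l * (t : ℂ) * g t
    let f0 : ℝ → ℂ := fun t => Complex.exp (-l * (t : ℂ) ^ 2 / 2)
    let fn : ℝ → ℂ := Dstar^[n] f0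
    (∃ g : SchwartzMap ℝ ℂ, ⇑g = fn) ∧ fn ≠ 0 ∧
      ∀ t : ℝ, Dstar (D fn) t = 2 * (n : ℂ) * (l.re : ℂ) * fn t := by
  intro D Dstar f0 fn
  have hvac : annihilation l (gaussianSchwartz l hl) = 0 := annihilation_gaussian l
  have hconj : l + (starRingEnd ℂ) l = 2 * (l.re : ℂ) := by
    rw [add_conj]
    push_cast
    rfl
  have hne : l + (starRingEnd ℂ) l ≠ 0 := by
    rw [hconj]
    exact mul_ne_zero two_ne_zero (ofReal_ne_zero.mpr hl.ne')
  have hg₀ : ⇑(gaussianSchwartz l hl) ≠ 0 := fun h => exp_ne_zero _ (congrFun h 0)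
  refine ⟨exists_schwartz_eq_iterate_creation _ (gaussianSchwartz l hl) n,
    iterate_creation_ne_zero hne _ hvac hg₀ n, fun t => ?_⟩
  have h := congrFun (creation_annihilation_iterate l ((starRingEnd ℂ) l) _ hvac n) t
  rw [hconj, Pi.smul_apply, smul_eq_mul] at h
  rw [mul_comm 2 (n : ℂ), mul_assoc (n : ℂ)]
  exact h
end

section
/- Let α be a natural number and u > 0 a real number with u ≠ 1. Then ∫₀^∞ (1 + x)^{−(α+1)}·(x + u)^{−1} dx = ((−1)^α/(u − 1)^{α+1})·(log u − Σ_{j=1}^{α} ((−1)^{j−1}/j)·(u − 1)^j). The right-hand side is the modified logarithm ℒ_α(u). -/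
open MeasureTheory

open Filter Topology

theorem tendsto_log_one_add_sub_log_add_atTop (u : ℝ) :
    Tendsto (fun x : ℝ => Real.log (1 + x) - Real.log (x + u)) atTop (𝓝 0) := by
  have h1 := Real.tendsto_log_comp_add_sub_log 1
  have h2 := Real.tendsto_log_comp_add_sub_log u
  have h := h1.sub h2
  rw [sub_zero] at h
  refine h.congr fun x => ?_
  rw [add_comm 1 x]
  ring

theorem tendsto_inv_one_add_pow_succ_atTop (n : ℕ) :
    Tendsto (fun x : ℝ => ((1 + x) ^ (n + 1))⁻¹) atTop (𝓝 0) :=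
  ((tendsto_pow_atTop n.succ_ne_zero).comp
    (tendsto_atTop_add_const_left atTop (1 : ℝ) tendsto_id)).inv_tendsto_atTop

theorem hasDerivAt_inv_one_add_pow_succ (n : ℕ) {x : ℝ} (hx : 1 + x ≠ 0) :
    HasDerivAt (fun y : ℝ => ((1 + y) ^ (n + 1))⁻¹) (-((n + 1) * ((1 + x) ^ (n + 2))⁻¹)) x := by
  have h := (((hasDerivAt_id x).const_add 1).fun_pow (n + 1)).fun_inv (pow_ne_zero _ hx)
  refine h.congr_deriv ?_
  simp only [id_eq, add_tsub_cancel_right, Nat.cast_add, Nat.cast_one]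
  field_simp
  ring

/-- The integrand has an antiderivative on `[0, ∞)` which vanishes at infinity, and whose value at
`0` is the opposite of the modified logarithm. -/
theorem exists_antiderivative_modified_logarithm (α : ℕ) {u : ℝ} (hu : 0 < u) (hu1 : u ≠ 1) :
    ∃ F : ℝ → ℝ,
      (∀ x ∈ Set.Ici (0 : ℝ), HasDerivAt F (((1 + x) ^ (α + 1))⁻¹ * (x + u)⁻¹) x) ∧
      Tendsto F atTop (𝓝 0) ∧
      F 0 = -(((-1 : ℝ) ^ α / (u - 1) ^ (α + 1)) *
        (Real.log u -
          ∑ j ∈ Finset.range α, ((-1 : ℝ) ^ j / (j + 1)) * (u - 1) ^ (j + 1))) := by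
  have hc : u - 1 ≠ 0 := sub_ne_zero.mpr hu1
  induction α with
  | zero =>
    refine ⟨fun x => (u - 1)⁻¹ * (Real.log (1 + x) - Real.log (x + u)), fun x hx => ?_, ?_, ?_⟩
    · have hx0 : 0 ≤ x := hx
      have h1 : 1 + x ≠ 0 := by positivity
      have h2 : x + u ≠ 0 := by positivity
      have h := ((((hasDerivAt_id x).const_add 1).log h1).sub
        (((hasDerivAt_id x).add_const u).log h2)).const_mul (u - 1)⁻¹
      refine h.congr_deriv ?_
      simp only [id_eq, zero_add, pow_one]
      field_simp
      ring
    · simpa using (tendsto_log_one_add_sub_log_add_atTop u).const_mul (u - 1)⁻¹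
    · simp
  | succ n ih =>
    obtain ⟨F, hF, hlim, h0⟩ := ih
    refine ⟨fun x => (u - 1)⁻¹ * (-((n + 1 : ℝ)⁻¹ * ((1 + x) ^ (n + 1))⁻¹) - F x),
      fun x hx => ?_, ?_, ?_⟩
    · have hx0 : 0 ≤ x := hx
      have h1 : 1 + x ≠ 0 := by positivity
      have h2 : x + u ≠ 0 := by positivity
      have hn : (n + 1 : ℝ) ≠ 0 := by positivity
      have h := ((((hasDerivAt_inv_one_add_pow_succ n h1).const_mul (n + 1 : ℝ)⁻¹).fun_neg).fun_sub
        (hF x hx)).const_mul (u - 1)⁻¹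
      refine h.congr_deriv ?_
      field_simp
      ring
    · simpa using
        ((((tendsto_inv_one_add_pow_succ_atTop n).const_mul (n + 1 : ℝ)⁻¹).neg).sub
          hlim).const_mul (u - 1)⁻¹
    · have hn : (n + 1 : ℝ) ≠ 0 := by positivity
      have hsq : ((-1 : ℝ) ^ n) * (-1) ^ n = 1 := by rw [← mul_pow]; simp
      simp only [h0, Finset.sum_range_succ, add_zero, one_pow, inv_one, mul_one]
      generalize ∑ j ∈ Finset.range n, ((-1 : ℝ) ^ j / (j + 1)) * (u - 1) ^ (j + 1) = S
      rw [pow_succ (-1 : ℝ) n]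
      generalize (-1 : ℝ) ^ n = e at hsq ⊢
      field_simp
      linear_combination (u - 1) ^ (2 * n + 3) * hsq

/-- The one-variable integral `H^{(1)}_{(α,0)}(u, m=0)`:
`∫₀^∞ (1+x)^{−(α+1)} (x+u)^{−1} dx` equals the modified logarithm
`ℒ_α(u) = ((−1)^α/(u−1)^{α+1})(log u − Σ_{j=1}^{α} ((−1)^{j−1}/j)(u−1)^j)`. -/
theorem integral_eq_modified_logarithm (α : ℕ) (u : ℝ) (hu : 0 < u) (hu1 : u ≠ 1) :
    ∫ x in Set.Ioi (0 : ℝ), ((1 + x) ^ (α + 1))⁻¹ * (x + u)⁻¹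
      = ((-1 : ℝ) ^ α / (u - 1) ^ (α + 1)) *
        (Real.log u - ∑ j ∈ Finset.range α, ((-1 : ℝ) ^ j / (j + 1)) * (u - 1) ^ (j + 1)) := by
  obtain ⟨F, hF, hlim, h0⟩ := exists_antiderivative_modified_logarithm α hu hu1
  rw [integral_Ioi_of_hasDerivAt_of_nonneg' hF (fun x hx => ?_) hlim, h0, zero_sub, neg_neg]
  have hx0 : 0 < x := hx
  positivity
end

section
/- For every real u > 0 with u ≠ 1, ∫₀^∞ x·(1 + x)^{−2}·(1 + u·x)^{−1} dx = (u − 1 − log u)/(u − 1)². Equivalently, the function F_γ(u) := −∫₀^∞ x·(1+x)^{−2}·(1+ux)^{−1} dx equals (log u − u + 1)/(u − 1)². -/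
open MeasureTheory

/-- An antiderivative of `x (1+x)^{-2} (1+ux)^{-1}` on the nonnegative half-line. -/
lemma hasDerivAt_antideriv_graded {u x : ℝ} (hu : 0 < u) (hu1 : u ≠ 1) (hx : 0 ≤ x) :
    HasDerivAt
      (fun y : ℝ => -Real.log (u + (1 - u) * (1 + y)⁻¹) / (u - 1) ^ 2 - (1 + y)⁻¹ / (u - 1))
      (x * ((1 + x) ^ 2)⁻¹ * (1 + u * x)⁻¹) x := by
  have h1 : 1 + x ≠ 0 := by positivity
  have h2 : 1 + u * x ≠ 0 := by positivity
  have h3 : u - 1 ≠ 0 := sub_ne_zero.mpr hu1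
  have heq : u + (1 - u) * (1 + x)⁻¹ = (1 + u * x) / (1 + x) := by
    field_simp
    ring
  have hne : u + (1 - u) * (1 + x)⁻¹ ≠ 0 := heq ▸ div_ne_zero h2 h1
  have hinv : HasDerivAt (fun y : ℝ => (1 + y)⁻¹) (-1 / (1 + x) ^ 2) x :=
    ((hasDerivAt_id x).const_add 1).fun_inv h1
  refine (((((hinv.const_mul (1 - u)).const_add u).log hne).fun_neg.div_const
    ((u - 1) ^ 2)).fun_sub (hinv.div_const (u - 1))).congr_deriv ?_
  rw [heq]
  field_simp
  ring

/-- The integral of `x (1+x)^{-2} (1+ux)^{-1}` over the positive half-line. -/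
lemma integral_Ioi_graded {u : ℝ} (hu : 0 < u) (hu1 : u ≠ 1) :
    ∫ x in Set.Ioi (0 : ℝ), x * ((1 + x) ^ 2)⁻¹ * (1 + u * x)⁻¹
      = (u - 1 - Real.log u) / (u - 1) ^ 2 := by
  have h3 : u - 1 ≠ 0 := sub_ne_zero.mpr hu1
  have hinv : Filter.Tendsto (fun y : ℝ => (1 + y)⁻¹) Filter.atTop (nhds 0) :=
    tendsto_inv_atTop_zero.comp (Filter.tendsto_atTop_add_const_left _ 1 Filter.tendsto_id)
  have hlim : Filter.Tendsto
      (fun y : ℝ => -Real.log (u + (1 - u) * (1 + y)⁻¹) / (u - 1) ^ 2 - (1 + y)⁻¹ / (u - 1))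
      Filter.atTop (nhds (-Real.log u / (u - 1) ^ 2)) := by
    have hlog : Filter.Tendsto (fun y : ℝ => u + (1 - u) * (1 + y)⁻¹) Filter.atTop (nhds u) := by
      simpa using (hinv.const_mul (1 - u)).const_add u
    simpa using ((hlog.log hu.ne').neg.div_const ((u - 1) ^ 2)).sub (hinv.div_const (u - 1))
  rw [integral_Ioi_of_hasDerivAt_of_nonneg'
    (fun x hx => hasDerivAt_antideriv_graded hu hu1 hx) (fun x hx => ?_) hlim]
  · simp only [add_zero, inv_one, mul_one, add_sub_cancel, Real.log_one]
    field_simp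
    ring
  · have hx0 : 0 < x := hx
    positivity

/-- `∫₀^∞ x (1+x)^{−2} (1+ux)^{−1} dx = (u − 1 − log u)/(u − 1)²`; equivalently the
one-variable modular curvature function of the graded Laplacian is
`F_γ(u) = −∫₀^∞ x(1+x)^{−2}(1+ux)^{−1} dx = (log u − u + 1)/(u − 1)²`. -/
theorem graded_one_variable_integral (u : ℝ) (hu : 0 < u) (hu1 : u ≠ 1) :
    (∫ x in Set.Ioi (0 : ℝ), x * ((1 + x) ^ 2)⁻¹ * (1 + u * x)⁻¹
      = (u - 1 - Real.log u) / (u - 1) ^ 2) ∧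
    (-∫ x in Set.Ioi (0 : ℝ), x * ((1 + x) ^ 2)⁻¹ * (1 + u * x)⁻¹
      = (Real.log u - u + 1) / (u - 1) ^ 2) := by
  rw [integral_Ioi_graded hu hu1]
  exact ⟨rfl, by ring⟩
end

section
/- Let u, v > 0 be real numbers with u ≠ v, u ≠ 1 and v ≠ 1. Then ∫₀^∞ x²·(1 + x)^{−2}·(1 + u·x)^{−1}·(1 + v·x)^{−1} dx = −(1/(v − u))·( (v − 1 − log v)/(v − 1)² − (u − 1 − log u)/(u − 1)² ). -/
open MeasureTheory

lemma hasDerivAt_log_one_add_sub_log_one_add_mul {w x : ℝ} (hw : 0 < w) (hw1 : w ≠ 1)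
    (hx : 0 ≤ x) :
    HasDerivAt (fun y : ℝ ↦ (Real.log (1 + y) - Real.log (1 + w * y)) / (w - 1) ^ 2
        - (1 + y)⁻¹ / (w - 1))
      (x * ((1 + x) ^ 2)⁻¹ * (1 + w * x)⁻¹) x := by
  have h1 : 1 + x ≠ 0 := by positivity
  have h2 : 1 + w * x ≠ 0 := by positivity
  have h3 : w - 1 ≠ 0 := sub_ne_zero.mpr hw1
  have d1 : HasDerivAt (fun y : ℝ ↦ 1 + y) 1 x := (hasDerivAt_id x).const_add 1
  have d2 : HasDerivAt (fun y : ℝ ↦ 1 + w * y) w x := by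
    simpa using ((hasDerivAt_id x).const_mul w).const_add 1
  refine ((((d1.log h1).sub (d2.log h2)).div_const ((w - 1) ^ 2)).sub
    ((d1.inv h1).div_const (w - 1))).congr_deriv ?_
  field_simp
  ring

lemma tendsto_log_one_add_sub_log_one_add_mul {w : ℝ} (hw : 0 < w) :
    Filter.Tendsto (fun x : ℝ ↦ Real.log (1 + x) - Real.log (1 + w * x)) Filter.atTop
      (nhds (-Real.log w)) := by
  have hlin : Filter.Tendsto (fun x : ℝ ↦ 1 + w * x) Filter.atTop Filter.atTop :=
    Filter.tendsto_atTop_add_const_left _ _ (Filter.tendsto_id.const_mul_atTop hw)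
  have hratio : Filter.Tendsto (fun x : ℝ ↦ w⁻¹ + (1 - w⁻¹) * (1 + w * x)⁻¹) Filter.atTop
      (nhds w⁻¹) := by
    simpa using ((tendsto_inv_atTop_zero.comp hlin).const_mul (1 - w⁻¹)).const_add w⁻¹
  rw [← Real.log_inv]
  refine (hratio.log (inv_ne_zero hw.ne')).congr' ?_
  filter_upwards [Filter.eventually_ge_atTop 0] with x hx
  have h1 : 1 + x ≠ 0 := by positivity
  have h2 : 1 + w * x ≠ 0 := by positivity
  rw [← Real.log_div h1 h2]
  congr 1
  field_simp
  ring

lemma tendsto_antideriv_mul_inv_one_add_sq_mul_inv {w : ℝ} (hw : 0 < w) :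
    Filter.Tendsto (fun y : ℝ ↦ (Real.log (1 + y) - Real.log (1 + w * y)) / (w - 1) ^ 2
        - (1 + y)⁻¹ / (w - 1)) Filter.atTop (nhds (-Real.log w / (w - 1) ^ 2)) := by
  have hinv : Filter.Tendsto (fun y : ℝ ↦ (1 + y)⁻¹) Filter.atTop (nhds 0) :=
    tendsto_inv_atTop_zero.comp (Filter.tendsto_atTop_add_const_left _ _ Filter.tendsto_id)
  simpa using ((tendsto_log_one_add_sub_log_one_add_mul hw).div_const ((w - 1) ^ 2)).sub
    (hinv.div_const (w - 1))

lemma mul_inv_one_add_sq_mul_inv_nonneg {w x : ℝ} (hw : 0 < w) (hx : x ∈ Set.Ioi 0) :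
    0 ≤ x * ((1 + x) ^ 2)⁻¹ * (1 + w * x)⁻¹ := by
  have : 0 < x := hx
  positivity

lemma integrableOn_mul_inv_one_add_sq_mul_inv {w : ℝ} (hw : 0 < w) (hw1 : w ≠ 1) :
    IntegrableOn (fun x : ℝ ↦ x * ((1 + x) ^ 2)⁻¹ * (1 + w * x)⁻¹) (Set.Ioi 0) :=
  integrableOn_Ioi_deriv_of_nonneg'
    (fun _ hx ↦ hasDerivAt_log_one_add_sub_log_one_add_mul hw hw1 hx)
    (fun _ hx ↦ mul_inv_one_add_sq_mul_inv_nonneg hw hx)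
    (tendsto_antideriv_mul_inv_one_add_sq_mul_inv hw)

lemma integral_mul_inv_one_add_sq_mul_inv {w : ℝ} (hw : 0 < w) (hw1 : w ≠ 1) :
    ∫ x in Set.Ioi (0 : ℝ), x * ((1 + x) ^ 2)⁻¹ * (1 + w * x)⁻¹
      = (w - 1 - Real.log w) / (w - 1) ^ 2 := by
  rw [integral_Ioi_of_hasDerivAt_of_nonneg'
    (fun _ hx ↦ hasDerivAt_log_one_add_sub_log_one_add_mul hw hw1 hx)
    (fun _ hx ↦ mul_inv_one_add_sq_mul_inv_nonneg hw hx)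
    (tendsto_antideriv_mul_inv_one_add_sq_mul_inv hw)]
  have h3 : w - 1 ≠ 0 := sub_ne_zero.mpr hw1
  simp only [add_zero, mul_zero, Real.log_one, sub_zero, zero_div, inv_one]
  field_simp
  ring

/-- The two-variable integral `H^{(2)}_{(1,0,0)}(u,v) = g₁(u,v)/2`:
`∫₀^∞ x²(1+x)^{−2}(1+ux)^{−1}(1+vx)^{−1} dx
  = −(ℒ₁(v) − ℒ₁(u))/(v − u)` with `ℒ₁(w) = (w − 1 − log w)/(w − 1)²`. -/
theorem two_variable_integral_g1 (u v : ℝ) (hu : 0 < u) (hv : 0 < v)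
    (huv : u ≠ v) (hu1 : u ≠ 1) (hv1 : v ≠ 1) :
    ∫ x in Set.Ioi (0 : ℝ), x ^ 2 * ((1 + x) ^ 2)⁻¹ * (1 + u * x)⁻¹ * (1 + v * x)⁻¹
      = -(1 / (v - u)) *
        ((v - 1 - Real.log v) / (v - 1) ^ 2 - (u - 1 - Real.log u) / (u - 1) ^ 2) := by
  rw [← integral_mul_inv_one_add_sq_mul_inv hv hv1, ← integral_mul_inv_one_add_sq_mul_inv hu hu1,
    ← integral_sub (integrableOn_mul_inv_one_add_sq_mul_inv hv hv1)
      (integrableOn_mul_inv_one_add_sq_mul_inv hu hu1), ← integral_const_mul]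
  refine setIntegral_congr_fun measurableSet_Ioi fun x (hx : 0 < x) ↦ ?_
  have h1 : 1 + u * x ≠ 0 := by positivity
  have h2 : 1 + v * x ≠ 0 := by positivity
  have h3 : 1 + x ≠ 0 := by positivity
  have h4 : v - u ≠ 0 := sub_ne_zero.mpr huv.symm
  field_simp
  ring
end

section
/- Let u, v > 0 be real numbers with u ≠ 1, v ≠ 1 and u·v ≠ 1. Then u·∫₀^∞ x·(1 + x)^{−1}·(1 + u·x)^{−2}·(1 + u·v·x)^{−1} dx = 1/((u − 1)(v − 1)) − u·log u/((u − 1)²·(uv − 1)) − v·log v/((v − 1)²·(uv − 1)). Equivalently, the function G₂(u,v) := −u·∫₀^∞ x(1+x)^{−1}(1+ux)^{−2}(1+uvx)^{−1} dx equals u·log u/((u−1)²(uv−1)) + v·log v/((v−1)²(uv−1)) − 1/((u−1)(v−1)). -/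
open MeasureTheory

/-- For `c > 0`, `log (1 + c x) - log (1 + x)` tends to `log c` at infinity. -/
theorem tendsto_log_one_add_mul_sub_log_one_add {c : ℝ} (hc : 0 < c) :
    Filter.Tendsto (fun x : ℝ => Real.log (1 + c * x) - Real.log (1 + x))
      Filter.atTop (nhds (Real.log c)) := by
  have h1 : Filter.Tendsto (fun x : ℝ => c + (1 - c) * (1 + x)⁻¹) Filter.atTop (nhds c) := by
    have h := (tendsto_inv_atTop_zero.comp
      (Filter.tendsto_atTop_add_const_left Filter.atTop (1 : ℝ) Filter.tendsto_id)).const_mul (1 - c)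
    simpa using h.const_add c
  refine (h1.log hc.ne').congr' ?_
  filter_upwards [Filter.eventually_gt_atTop 0] with x hx
  have hx1 : 0 < 1 + x := by positivity
  have hcx : 0 < 1 + c * x := by positivity
  rw [← Real.log_div hcx.ne' hx1.ne']
  congr 1
  field_simp
  ring

theorem hasDerivAt_log_one_add_mul {c x : ℝ} (h : 1 + c * x ≠ 0) :
    HasDerivAt (fun y : ℝ => Real.log (1 + c * y)) (c / (1 + c * x)) x := by
  simpa using (((hasDerivAt_id x).const_mul c).const_add 1).log h

theorem hasDerivAt_inv_one_add_mul {c x : ℝ} (h : 1 + c * x ≠ 0) :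
    HasDerivAt (fun y : ℝ => (1 + c * y)⁻¹) (-c / (1 + c * x) ^ 2) x := by
  simpa using (((hasDerivAt_id x).const_mul c).const_add 1).fun_inv h

theorem integral_Ioi_mul_inv_one_add_mul (u v : ℝ) (hu : 0 < u) (hv : 0 < v)
    (hu1 : u ≠ 1) (hv1 : v ≠ 1) (huv1 : u * v ≠ 1) :
    ∫ x in Set.Ioi (0 : ℝ), x * (1 + x)⁻¹ * ((1 + u * x) ^ 2)⁻¹ * (1 + u * v * x)⁻¹
      = (v / (u * (u * v - 1) * (v - 1) ^ 2) - 1 / ((u - 1) ^ 2 * (u * v - 1))) * Real.log u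
        - v / (u * (u * v - 1) * (v - 1) ^ 2) * Real.log (u * v)
        + 1 / (u * (u - 1) * (v - 1)) := by
  have hu1' : u - 1 ≠ 0 := sub_ne_zero.mpr hu1
  have hv1' : v - 1 ≠ 0 := sub_ne_zero.mpr hv1
  have huv1' : u * v - 1 ≠ 0 := sub_ne_zero.mpr huv1
  have huv : 0 < u * v := mul_pos hu hv
  set δ := v / (u * (u * v - 1) * (v - 1) ^ 2) with hδ
  set α := 1 / ((u - 1) ^ 2 * (u * v - 1)) with hα
  set γ := 1 / (u * (u - 1) * (v - 1)) with hγ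
  have hderiv : ∀ x ∈ Set.Ici (0 : ℝ), HasDerivAt
      (fun y : ℝ => (δ - α) * (Real.log (1 + u * y) - Real.log (1 + y))
        - δ * (Real.log (1 + u * v * y) - Real.log (1 + y)) - γ * (1 + u * y)⁻¹)
      (x * (1 + x)⁻¹ * ((1 + u * x) ^ 2)⁻¹ * (1 + u * v * x)⁻¹) x := by
    intro x hx
    have hx0 : 0 ≤ x := hx
    have h1 : 1 + x ≠ 0 := by positivity
    have h2 : 1 + u * x ≠ 0 := by positivity
    have h3 : 1 + u * v * x ≠ 0 := by positivity
    have hlog : HasDerivAt (fun y : ℝ => Real.log (1 + y)) (1 / (1 + x)) x := by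
      simpa using hasDerivAt_log_one_add_mul (c := 1) (x := x) (by simpa using h1)
    refine (((((hasDerivAt_log_one_add_mul h2).sub hlog).const_mul (δ - α)).sub
      (((hasDerivAt_log_one_add_mul h3).sub hlog).const_mul δ)).sub
      ((hasDerivAt_inv_one_add_mul h2).const_mul γ)).congr_deriv ?_
    have h4 : v * u - 1 ≠ 0 := by rwa [mul_comm]
    rw [hδ, hα, hγ]
    field_simp
    ring
  have hinv : Filter.Tendsto (fun x : ℝ => (1 + u * x)⁻¹) Filter.atTop (nhds 0) :=
    tendsto_inv_atTop_zero.comp (Filter.tendsto_atTop_add_const_left Filter.atTop (1 : ℝ)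
      (Filter.tendsto_id.const_mul_atTop hu))
  have hlim := (((tendsto_log_one_add_mul_sub_log_one_add hu).const_mul (δ - α)).sub
    ((tendsto_log_one_add_mul_sub_log_one_add huv).const_mul δ)).sub (hinv.const_mul γ)
  rw [integral_Ioi_of_hasDerivAt_of_nonneg' hderiv (fun x hx => ?_) hlim]
  · simp
  · have hx0 : 0 < x := hx
    positivity

/-- The modular curvature function `G₂ = G^Im_γ`:
`u·∫₀^∞ x(1+x)^{−1}(1+ux)^{−2}(1+uvx)^{−1} dx
 = 1/((u−1)(v−1)) − u log u/((u−1)²(uv−1)) − v log v/((v−1)²(uv−1))`;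
equivalently `G₂(u,v) := −u·∫₀^∞ x(1+x)^{−1}(1+ux)^{−2}(1+uvx)^{−1} dx` equals
`u log u/((u−1)²(uv−1)) + v log v/((v−1)²(uv−1)) − 1/((u−1)(v−1))`. -/
theorem two_variable_integral_g2 (u v : ℝ) (hu : 0 < u) (hv : 0 < v)
    (hu1 : u ≠ 1) (hv1 : v ≠ 1) (huv1 : u * v ≠ 1) :
    (u * ∫ x in Set.Ioi (0 : ℝ), x * (1 + x)⁻¹ * ((1 + u * x) ^ 2)⁻¹ * (1 + u * v * x)⁻¹
      = 1 / ((u - 1) * (v - 1)) - u * Real.log u / ((u - 1) ^ 2 * (u * v - 1))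
        - v * Real.log v / ((v - 1) ^ 2 * (u * v - 1))) ∧
    (-(u * ∫ x in Set.Ioi (0 : ℝ), x * (1 + x)⁻¹ * ((1 + u * x) ^ 2)⁻¹ * (1 + u * v * x)⁻¹)
      = u * Real.log u / ((u - 1) ^ 2 * (u * v - 1))
        + v * Real.log v / ((v - 1) ^ 2 * (u * v - 1)) - 1 / ((u - 1) * (v - 1))) := by
  have hu1' : u - 1 ≠ 0 := sub_ne_zero.mpr hu1
  have hv1' : v - 1 ≠ 0 := sub_ne_zero.mpr hv1
  have huv1' : u * v - 1 ≠ 0 := sub_ne_zero.mpr huv1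
  rw [integral_Ioi_mul_inv_one_add_mul u v hu hv hu1 hv1 huv1, Real.log_mul hu.ne' hv.ne']
  constructor <;>
  · field_simp
    ring
end

section
/- Let α₀, α₁ be natural numbers and let v > 0 with v ≠ 1. Define the modified logarithm ℒ_α(w) = ((−1)^α/(w−1)^{α+1})·(log w − Σ_{j=1}^{α}((−1)^{j−1}/j)(w−1)^j). Then for every u > 0 with u ≠ 1 and u ≠ v, ∫₀^∞ (1 + x)^{−α₀−1}·(x + u)^{−α₁−1}·(x + v)^{−1} dx = ((−1)^{α₁+1}/α₁!) · (d/du)^{α₁} [ (ℒ_{α₀}(v) − ℒ_{α₀}(u)) / (v − u) ], where the iterated derivative is taken in the variable u. -/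
open MeasureTheory

/-- The modified logarithm
`ℒ_α(w) = ((−1)^α/(w−1)^{α+1})(log w − Σ_{j=1}^{α}((−1)^{j−1}/j)(w−1)^j)`. -/
noncomputable def modLog (α : ℕ) (w : ℝ) : ℝ :=
  ((-1 : ℝ) ^ α / (w - 1) ^ (α + 1)) *
    (Real.log w - ∑ j ∈ Finset.range α, ((-1 : ℝ) ^ j / (j + 1)) * (w - 1) ^ (j + 1))

theorem integral_inv_one_add_pow (k : ℕ) :
    IntegrableOn (fun x : ℝ => ((1 + x) ^ (k + 2))⁻¹) (Set.Ioi 0) ∧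
      ∫ x in Set.Ioi (0 : ℝ), ((1 + x) ^ (k + 2))⁻¹ = ((k : ℝ) + 1)⁻¹ := by
  have hder : ∀ x ∈ Set.Ici (0 : ℝ),
      HasDerivAt (fun x : ℝ => -((k : ℝ) + 1)⁻¹ * ((1 + x) ^ (k + 1))⁻¹)
        ((1 + x) ^ (k + 2))⁻¹ x := by
    intro x hx
    have hx0 : (1 + x) ≠ 0 := by have : (0 : ℝ) ≤ x := hx; positivity
    have hk : (k : ℝ) + 1 ≠ 0 := by positivity
    refine HasDerivAt.congr_deriv (((((hasDerivAt_id x).const_add 1).pow (k + 1)).inv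
      (pow_ne_zero _ hx0)).const_mul (-((k : ℝ) + 1)⁻¹)) ?_
    simp only [id, Pi.pow_apply, Nat.add_sub_cancel]
    push_cast
    field_simp
    ring
  have htend : Filter.Tendsto (fun x : ℝ => -((k : ℝ) + 1)⁻¹ * ((1 + x) ^ (k + 1))⁻¹)
      Filter.atTop (nhds 0) := by
    have h := ((Filter.tendsto_pow_atTop (α := ℝ) (Nat.succ_ne_zero k)).comp
      (Filter.tendsto_atTop_add_const_left Filter.atTop (1 : ℝ) Filter.tendsto_id)).inv_tendsto_atTop
    simpa using h.const_mul (-((k : ℝ) + 1)⁻¹)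
  have hint := integrableOn_Ioi_deriv_of_nonneg' hder
    (fun x hx => by have : (0 : ℝ) < x := hx; positivity) htend
  refine ⟨hint, ?_⟩
  rw [integral_Ioi_of_hasDerivAt_of_tendsto' hder hint htend]
  simp

theorem integrableOn_inv_one_add_pow_mul_inv (a : ℕ) {w : ℝ} (hw : 0 < w) :
    IntegrableOn (fun x : ℝ => ((1 + x) ^ (a + 1))⁻¹ * (x + w)⁻¹) (Set.Ioi 0) := by
  refine Integrable.mono' ((integral_inv_one_add_pow a).1.const_mul (1 + w⁻¹))
    (by fun_prop) ?_
  filter_upwards [ae_restrict_mem measurableSet_Ioi] with x hx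
  have hx : 0 < x := hx
  rw [Real.norm_of_nonneg (by positivity), pow_succ (1 + x) (a + 1), mul_inv]
  have h : (x + w)⁻¹ ≤ (1 + w⁻¹) * (1 + x)⁻¹ := by
    rw [← div_eq_mul_inv, inv_eq_one_div, div_le_div_iff₀ (by positivity) (by positivity)]
    have : (1 + w⁻¹) * (x + w) = x + w + w⁻¹ * x + 1 := by
      field_simp
      ring
    rw [this]
    have : 0 < w⁻¹ * x := by positivity
    linarith
  calc _ ≤ ((1 + x) ^ (a + 1))⁻¹ * ((1 + w⁻¹) * (1 + x)⁻¹) := by gcongr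
    _ = _ := by ring

theorem modLog_succ (a : ℕ) {w : ℝ} (hw1 : w ≠ 1) :
    modLog (a + 1) w = (w - 1)⁻¹ * (((a : ℝ) + 1)⁻¹ - modLog a w) := by
  have h : w - 1 ≠ 0 := sub_ne_zero.mpr hw1
  have hs : ((-1 : ℝ) ^ a) ^ 2 = 1 := by rw [← pow_mul, mul_comm, pow_mul]; simp
  have ha : (a : ℝ) + 1 ≠ 0 := by positivity
  unfold modLog
  rw [Finset.sum_range_succ]
  generalize ∑ j ∈ Finset.range a, ((-1 : ℝ) ^ j / (j + 1)) * (w - 1) ^ (j + 1) = S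
  field_simp
  linear_combination (w - 1) ^ (2 * a + 3) * hs

theorem integral_eq_modLog (a : ℕ) {w : ℝ} (hw : 0 < w) (hw1 : w ≠ 1) :
    ∫ x in Set.Ioi (0 : ℝ), ((1 + x) ^ (a + 1))⁻¹ * (x + w)⁻¹ = modLog a w := by
  have h1 : w - 1 ≠ 0 := sub_ne_zero.mpr hw1
  induction a with
  | zero =>
    have hder : ∀ x ∈ Set.Ici (0 : ℝ),
        HasDerivAt (fun x : ℝ => (w - 1)⁻¹ * Real.log ((1 + x) / (x + w)))
          (((1 + x) ^ (0 + 1))⁻¹ * (x + w)⁻¹) x := by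
      intro x hx
      have hx : (0 : ℝ) ≤ x := hx
      have hx0 : (1 + x) ≠ 0 := by positivity
      have hx1 : (x + w) ≠ 0 := by positivity
      refine HasDerivAt.congr_deriv (((((hasDerivAt_id x).const_add 1).div ((hasDerivAt_id x).add_const w) hx1).log
        (div_ne_zero hx0 hx1)).const_mul (w - 1)⁻¹) ?_
      simp only [id, Pi.div_apply]
      field_simp
      ring
    have htend : Filter.Tendsto (fun x : ℝ => (w - 1)⁻¹ * Real.log ((1 + x) / (x + w)))
        Filter.atTop (nhds 0) := by
      have h : Filter.Tendsto (fun x : ℝ => 1 + (1 - w) * (x + w)⁻¹) Filter.atTop (nhds 1) := by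
        simpa using ((tendsto_inv_atTop_zero.comp (Filter.tendsto_atTop_add_const_right
          Filter.atTop w Filter.tendsto_id)).const_mul (1 - w)).const_add 1
      have h' : Filter.Tendsto (fun x : ℝ => (1 + x) / (x + w)) Filter.atTop (nhds 1) := by
        refine h.congr' ?_
        filter_upwards [Filter.eventually_gt_atTop 0] with x hx
        field_simp
        ring
      simpa using (h'.log one_ne_zero).const_mul (w - 1)⁻¹
    rw [integral_Ioi_of_hasDerivAt_of_tendsto' hder
      (integrableOn_inv_one_add_pow_mul_inv 0 hw) htend]
    simp [modLog, div_eq_mul_inv]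
  | succ a ih =>
    rw [modLog_succ a hw1, ← ih, ← (integral_inv_one_add_pow a).2,
      ← integral_sub (integral_inv_one_add_pow a).1
        (integrableOn_inv_one_add_pow_mul_inv a hw), ← integral_const_mul]
    refine setIntegral_congr_fun measurableSet_Ioi fun x hx => ?_
    have hx : 0 < x := hx
    have : 1 + x ≠ 0 := by positivity
    field_simp
    ring

theorem integrableOn_mul_inv_add_pow {g : ℝ → ℝ} (hg : IntegrableOn g (Set.Ioi 0)) (n : ℕ)
    {u : ℝ} (hu : 0 < u) :
    IntegrableOn (fun x => g x * ((x + u) ^ n)⁻¹) (Set.Ioi 0) := by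
  refine Integrable.mul_bdd (c := (u ^ n)⁻¹) hg (by fun_prop) ?_
  filter_upwards [ae_restrict_mem measurableSet_Ioi] with x hx
  have hx : 0 < x := hx
  rw [Real.norm_of_nonneg (by positivity)]
  gcongr
  linarith

theorem hasDerivAt_integral_mul_inv_add_pow {g : ℝ → ℝ} (hg : IntegrableOn g (Set.Ioi 0))
    (n : ℕ) {u : ℝ} (hu : 0 < u) :
    HasDerivAt (fun w => ∫ x in Set.Ioi (0 : ℝ), g x * ((x + w) ^ (n + 1))⁻¹)
      (-((n : ℝ) + 1) * ∫ x in Set.Ioi (0 : ℝ), g x * ((x + u) ^ (n + 2))⁻¹) u := by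
  rw [← integral_const_mul]
  refine (hasDerivAt_integral_of_dominated_loc_of_deriv_le
    (μ := volume.restrict (Set.Ioi 0)) (F := fun w x => g x * ((x + w) ^ (n + 1))⁻¹)
    (F' := fun w x => -((n : ℝ) + 1) * (g x * ((x + w) ^ (n + 2))⁻¹))
    (bound := fun x => ((n : ℝ) + 1) * (‖g x‖ * ((u / 2) ^ (n + 2))⁻¹))
    (Ioi_mem_nhds (half_lt_self hu)) ?_ (integrableOn_mul_inv_add_pow hg _ hu)
    ((integrableOn_mul_inv_add_pow hg _ hu).const_mul _).aestronglyMeasurable ?_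
    ((hg.norm.mul_const _).const_mul _) ?_).2
  · filter_upwards [Ioi_mem_nhds hu] with w hw
    exact (integrableOn_mul_inv_add_pow hg _ hw).aestronglyMeasurable
  · filter_upwards [ae_restrict_mem measurableSet_Ioi] with x hx w hw
    have hx : 0 < x := hx
    have hw : u / 2 < w := hw
    have hw0 : 0 < w := by linarith
    rw [norm_mul, norm_mul, norm_neg, Real.norm_of_nonneg (by positivity : (0 : ℝ) ≤ n + 1),
      Real.norm_of_nonneg (by positivity : 0 ≤ ((x + w) ^ (n + 2))⁻¹)]
    gcongr
    linarith
  · filter_upwards [ae_restrict_mem measurableSet_Ioi] with x hx w hw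
    have hx : 0 < x := hx
    have hw : u / 2 < w := hw
    have hw0 : x + w ≠ 0 := by linarith
    refine HasDerivAt.congr_deriv (((((hasDerivAt_id w).const_add x).pow (n + 1)).inv
      (pow_ne_zero _ hw0)).const_mul (g x)) ?_
    simp only [id, Pi.pow_apply, Nat.add_sub_cancel]
    push_cast
    field_simp
    ring

theorem iteratedDeriv_integral_mul_inv_add {g : ℝ → ℝ} (hg : IntegrableOn g (Set.Ioi 0))
    (n : ℕ) {u : ℝ} (hu : 0 < u) :
    iteratedDeriv n (fun w => ∫ x in Set.Ioi (0 : ℝ), g x * (x + w)⁻¹) u =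
      (-1) ^ n * (n.factorial : ℝ) * ∫ x in Set.Ioi (0 : ℝ), g x * ((x + u) ^ (n + 1))⁻¹ := by
  induction n generalizing u with
  | zero => simp
  | succ n ih =>
    have h : iteratedDeriv n (fun w => ∫ x in Set.Ioi (0 : ℝ), g x * (x + w)⁻¹) =ᶠ[nhds u]
        fun w => (-1) ^ n * (n.factorial : ℝ) *
          ∫ x in Set.Ioi (0 : ℝ), g x * ((x + w) ^ (n + 1))⁻¹ := by
      filter_upwards [Ioi_mem_nhds hu] with w hw using ih hw
    rw [iteratedDeriv_succ, h.deriv_eq,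
      ((hasDerivAt_integral_mul_inv_add_pow hg n hu).const_mul _).deriv, Nat.factorial_succ]
    push_cast
    ring

/-- The two-variable integral `H^{(2)}_{(α₀,α₁,0)}(u,v,m=0)` in terms of the
modified logarithm:
`∫₀^∞ (1+x)^{−α₀−1}(x+u)^{−α₁−1}(x+v)^{−1} dx
 = ((−1)^{α₁+1}/α₁!) ∂_u^{α₁} [(ℒ_{α₀}(v) − ℒ_{α₀}(u))/(v − u)]`. -/
theorem two_variable_integral_formula (α₀ α₁ : ℕ) (v : ℝ) (hv : 0 < v) (hv1 : v ≠ 1)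
    (u : ℝ) (hu : 0 < u) (hu1 : u ≠ 1) (huv : u ≠ v) :
    ∫ x in Set.Ioi (0 : ℝ), ((1 + x) ^ (α₀ + 1))⁻¹ * ((x + u) ^ (α₁ + 1))⁻¹ * (x + v)⁻¹
      = ((-1 : ℝ) ^ (α₁ + 1) / (Nat.factorial α₁ : ℝ)) *
        iteratedDeriv α₁ (fun w => (modLog α₀ v - modLog α₀ w) / (v - w)) u := by
  have hg := integrableOn_inv_one_add_pow_mul_inv α₀ hv
  have h : (fun w => (modLog α₀ v - modLog α₀ w) / (v - w)) =ᶠ[nhds u]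
      fun w => -∫ x in Set.Ioi (0 : ℝ), ((1 + x) ^ (α₀ + 1))⁻¹ * (x + v)⁻¹ * (x + w)⁻¹ := by
    filter_upwards [Ioi_mem_nhds hu, isOpen_ne.mem_nhds hu1, isOpen_ne.mem_nhds huv]
      with w hw hw1 hwv
    have hw : 0 < w := hw
    have hvw : v - w ≠ 0 := sub_ne_zero.mpr (Ne.symm hwv)
    rw [← integral_eq_modLog α₀ hv hv1, ← integral_eq_modLog α₀ hw hw1,
      ← integral_sub hg (integrableOn_inv_one_add_pow_mul_inv α₀ hw), ← integral_div,
      ← integral_neg]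
    refine setIntegral_congr_fun measurableSet_Ioi fun x hx => ?_
    have hx : 0 < x := hx
    field_simp
    ring
  rw [h.iteratedDeriv_eq, iteratedDeriv_fun_neg, iteratedDeriv_integral_mul_inv_add hg _ hu]
  have hs : ((-1 : ℝ) ^ α₁) ^ 2 = 1 := by rw [← pow_mul, mul_comm, pow_mul]; simp
  have hf : (α₁.factorial : ℝ) ≠ 0 := by positivity
  have hc : ∀ I : ℝ, (-1 : ℝ) ^ (α₁ + 1) / (α₁.factorial : ℝ) *
      -((-1) ^ α₁ * (α₁.factorial : ℝ) * I) = I := by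
    intro I
    field_simp
    linear_combination I * hs
  rw [hc]
  exact integral_congr_ae (.of_forall fun x => by ring)
end

section
/- Let n ≥ 1, let m be a real number with m < −n, and let f : ℝⁿ → ℂ be a smooth function satisfying Hörmander symbol estimates of order m: for every multi-index β there is C_β > 0 with |∂^β f(ξ)| ≤ C_β·(1 + ‖ξ‖)^{m − |β|} for all ξ ∈ ℝⁿ. Then the Fourier transform f̂(x) = ∫_{ℝⁿ} e^{−i⟨x,ξ⟩} f(ξ) dξ (which converges absolutely) decays rapidly: for every natural number N there exists C > 0 such that ‖x‖ᴺ·|f̂(x)| ≤ C for all x ∈ ℝⁿ. In particular, if χ is any smooth function vanishing near 0 and constant 1 outside a compact set, χ·f̂ is rapidly decreasing. -/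
open MeasureTheory Complex
open scoped RealInnerProductSpace

theorem integrable_of_norm_le_one_add_norm_rpow {E F : Type*} [NormedAddCommGroup E]
    [NormedSpace ℝ E] [FiniteDimensional ℝ E] [MeasurableSpace E] [BorelSpace E]
    [NormedAddCommGroup F] {μ : Measure E} [μ.IsAddHaarMeasure] {g : E → F}
    (hg : AEStronglyMeasurable g μ) {C r : ℝ} (hr : r < -(Module.finrank ℝ E : ℝ))
    (hgC : ∀ ξ, ‖g ξ‖ ≤ C * (1 + ‖ξ‖) ^ r) : Integrable g μ := by
  have h : Integrable (fun ξ : E => C * (1 + ‖ξ‖) ^ (- -r)) μ :=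
    (integrable_one_add_norm (lt_neg_of_lt_neg hr)).const_mul C
  rw [neg_neg] at h
  exact h.mono' hg (Filter.Eventually.of_forall hgC)

theorem integral_exp_neg_I_inner_mul_eq_fourier {V : Type*} [NormedAddCommGroup V]
    [InnerProductSpace ℝ V] [FiniteDimensional ℝ V] [MeasurableSpace V] [BorelSpace V]
    (f : V → ℂ) (x : V) :
    ∫ ξ, Complex.exp (-Complex.I * (⟪x, ξ⟫ : ℝ)) * f ξ =
      FourierTransform.fourier f ((2 * Real.pi)⁻¹ • x) := by
  rw [Real.fourier_eq']
  refine integral_congr_ae (Filter.Eventually.of_forall fun ξ => ?_)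
  have h : -2 * Real.pi * ⟪ξ, (2 * Real.pi)⁻¹ • x⟫ = -⟪x, ξ⟫ := by
    rw [real_inner_smul_right, real_inner_comm]
    field_simp
  simp only [h, smul_eq_mul]
  rw [Complex.ofReal_neg, neg_mul, neg_mul, mul_comm Complex.I]

theorem exists_pow_mul_norm_fourier_le {V E : Type*} [NormedAddCommGroup V]
    [InnerProductSpace ℝ V] [FiniteDimensional ℝ V] [MeasurableSpace V] [BorelSpace V]
    [NormedAddCommGroup E] [NormedSpace ℂ E] {f : V → E} (hf : ContDiff ℝ (⊤ : ℕ∞) f)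
    (hint : ∀ k : ℕ, Integrable (iteratedFDeriv ℝ k f)) (N : ℕ) :
    ∃ C > 0, ∀ w : V, ‖w‖ ^ N * ‖FourierTransform.fourier f w‖ ≤ C := by
  have key (w : V) := Real.pow_mul_norm_iteratedFDeriv_fourier_le (K := 0) hf
    (fun k n hk _ => by
      obtain rfl : k = 0 := by simpa using hk
      simpa using (hint n).norm) (k := 0) (n := N) le_rfl le_top w
  simp only [norm_iteratedFDeriv_zero] at key
  exact ⟨_, lt_max_of_lt_right one_pos, fun w => (key w).trans (le_max_left _ 1)⟩

/-- The Fourier transform of a Hörmander symbol of order `m < −n` on `ℝⁿ` decays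
rapidly away from `0`: if `f` is smooth and all its derivatives of order `k`
are bounded by `C_k (1+‖ξ‖)^{m−k}`, then `f̂(x) = ∫ e^{−i⟨x,ξ⟩} f(ξ) dξ`
converges absolutely and satisfies `‖x‖^N |f̂(x)| ≤ C_N` for every `N`. -/
theorem symbol_fourier_transform_rapid_decay (n : ℕ) (hn : 1 ≤ n) (m : ℝ)
    (hm : m < -(n : ℝ)) (f : EuclideanSpace ℝ (Fin n) → ℂ)
    (hf : ContDiff ℝ (⊤ : ℕ∞) f)
    (hsym : ∀ k : ℕ, ∃ C > 0, ∀ ξ : EuclideanSpace ℝ (Fin n),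
      ‖iteratedFDeriv ℝ k f ξ‖ ≤ C * (1 + ‖ξ‖) ^ (m - (k : ℝ))) :
    (∀ x : EuclideanSpace ℝ (Fin n),
      Integrable (fun ξ : EuclideanSpace ℝ (Fin n) =>
        Complex.exp (-Complex.I * (⟪x, ξ⟫ : ℝ)) * f ξ)) ∧
    ∀ N : ℕ, ∃ C > 0, ∀ x : EuclideanSpace ℝ (Fin n),
      ‖x‖ ^ N * ‖∫ ξ : EuclideanSpace ℝ (Fin n),
        Complex.exp (-Complex.I * (⟪x, ξ⟫ : ℝ)) * f ξ‖ ≤ C := by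
  have hint (k : ℕ) : Integrable (iteratedFDeriv ℝ k f) := by
    obtain ⟨C, -, hC⟩ := hsym k
    refine integrable_of_norm_le_one_add_norm_rpow
      (hf.continuous_iteratedFDeriv (mod_cast le_top)).aestronglyMeasurable ?_ hC
    rw [finrank_euclideanSpace_fin]
    linarith [k.cast_nonneg (α := ℝ)]
  have hf_int : Integrable f :=
    (integrable_norm_iff hf.continuous.aestronglyMeasurable).1 (by simpa using (hint 0).norm)
  refine ⟨fun x => ?_, fun N => ?_⟩
  · refine hf_int.bdd_mul (c := 1) (by fun_prop) (Filter.Eventually.of_forall fun ξ => ?_)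
    simp [Complex.norm_exp]
  · obtain ⟨C, hC, hle⟩ := exists_pow_mul_norm_fourier_le hf hint N
    refine ⟨(2 * Real.pi) ^ N * C, by positivity, fun x => ?_⟩
    have hx : ‖x‖ = 2 * Real.pi * ‖(2 * Real.pi)⁻¹ • x‖ := by
      rw [norm_smul, Real.norm_of_nonneg (by positivity)]
      field_simp
    rw [integral_exp_neg_I_inner_mul_eq_fourier, hx, mul_pow, mul_assoc]
    gcongr
    exact hle _
end

section
/- Let m < −2 be real, a > 0, and let f : ℝ² × [1, ∞) → ℂ be such that for each λ ≥ 1 the function ξ ↦ f(ξ, λ) is smooth and the parameter-dependent symbol estimates hold: for every multi-index β there is C_β > 0 with |∂_ξ^β f(ξ, λ)| ≤ C_β·(1 + ‖ξ‖ + λ)^{m − |β|} for all ξ ∈ ℝ², λ ≥ 1. Then for every natural number N there exists C > 0 such that for all λ ≥ 1: | Σ_{ℓ ∈ ℤ²} f(a·ℓ, λ) − a^{−2}·∫_{ℝ²} f(ξ, λ) dξ | ≤ C·λ^{−N}. That is, the lattice sum of a parameter-dependent symbol of order < −2 equals a^{−2} times its integral up to an O(λ^{−∞}) error. -/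
open MeasureTheory Complex

open scoped FourierTransform

/-- The weight `(1 + |x|)^(-s)` on the real line. -/
noncomputable def decayWeight (s x : ℝ) : ℝ := (1 + ‖x‖) ^ (-s)

namespace decayWeight

variable {s : ℝ}

lemma nonneg (s x : ℝ) : 0 ≤ decayWeight s x := by
  unfold decayWeight; positivity

lemma le_one (hs : 1 < s) (x : ℝ) : decayWeight s x ≤ 1 :=
  Real.rpow_le_one_of_one_le_of_nonpos (by linarith [norm_nonneg x]) (by linarith)

lemma integrable (hs : 1 < s) : Integrable (decayWeight s) :=
  integrable_one_add_norm (by simpa using hs)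

lemma le_abs_rpow (hs : 1 < s) {x : ℝ} (hx : x ≠ 0) : decayWeight s x ≤ |x| ^ (-s) :=
  Real.rpow_le_rpow_of_nonpos (abs_pos.2 hx) (by simp) (by linarith)

lemma isBigO (hs : 1 < s) :
    decayWeight s =O[Filter.cocompact ℝ] fun x : ℝ => |x| ^ (-s) := by
  refine Asymptotics.IsBigO.of_bound 1 ?_
  filter_upwards [(isCompact_singleton (x := (0 : ℝ))).compl_mem_cocompact] with x hx
  rw [Real.norm_of_nonneg (nonneg s x), Real.norm_of_nonneg (by positivity), one_mul]
  exact le_abs_rpow hs hx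

lemma summable_int (hs : 1 < s) : Summable fun n : ℤ => decayWeight s n :=
  summable_of_isBigO (Real.summable_abs_int_rpow hs)
    ((isBigO hs).comp_tendsto Int.tendsto_coe_cofinite)

end decayWeight

/-- If a function on the line and its derivatives up to order `k ≥ 2` are dominated by
`decayWeight s`, its sum over `ℤ` differs from its integral by at most a constant times the bound
on the `k`-th derivative. -/
lemma norm_tsum_int_sub_integral_le {k : ℕ} (hk : 2 ≤ k) {s : ℝ} (hs : 1 < s) {g : ℝ → ℂ}
    (hg : ContDiff ℝ k g) {B : ℕ → ℝ}
    (hB : ∀ j ≤ k, ∀ t, ‖iteratedDeriv j g t‖ ≤ B j * decayWeight s t) :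
    ‖(∑' n : ℤ, g n) - ∫ t, g t‖ ≤
      (∑' n : ℤ, |1 / (n : ℝ) ^ k|) * (B k * ∫ t, decayWeight s t) := by
  have hsum : Summable fun n : ℤ => |1 / (n : ℝ) ^ k| :=
    (Real.summable_one_div_int_pow.2 hk).abs
  have hint (j : ℕ) (hj : j ≤ k) : Integrable (iteratedDeriv j g) :=
    ((decayWeight.integrable hs).const_mul (B j)).mono'
      (hg.continuous_iteratedDeriv j (mod_cast hj)).aestronglyMeasurable
      (.of_forall (hB j hj))
  have hO : g =O[Filter.cocompact ℝ] fun x : ℝ => |x| ^ (-s) := by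
    refine Asymptotics.IsBigO.trans ?_ (decayWeight.isBigO hs)
    refine Asymptotics.IsBigO.of_bound (B 0) (.of_forall fun t => ?_)
    rw [Real.norm_of_nonneg (decayWeight.nonneg s t)]
    simpa using hB 0 zero_le t
  have hM : ∫ t, ‖iteratedDeriv k g t‖ ≤ B k * ∫ t, decayWeight s t := by
    rw [← integral_const_mul]
    exact integral_mono (hint k le_rfl).norm ((decayWeight.integrable hs).const_mul _)
      (hB k le_rfl)
  have hF (n : ℤ) (hn : n ≠ 0) :
      ‖𝓕 g (n : ℝ)‖ ≤ |1 / (n : ℝ) ^ k| * (B k * ∫ t, decayWeight s t) := by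
    have h1 := congrFun (Real.fourier_iteratedDeriv (N := (k : ℕ∞)) (mod_cast hg)
      (fun j hj => hint j (mod_cast hj)) le_rfl) (n : ℝ)
    have h2 : ‖𝓕 (iteratedDeriv k g) (n : ℝ)‖ ≤ ∫ t, ‖iteratedDeriv k g t‖ :=
      VectorFourier.norm_fourierIntegral_le_integral_norm _ _ _ _ _
    have hn' : (0 : ℝ) < |(n : ℝ)| := abs_pos.2 (mod_cast hn)
    have h3 : |(n : ℝ)| ^ k * ‖𝓕 g (n : ℝ)‖ ≤ ‖𝓕 (iteratedDeriv k g) (n : ℝ)‖ := by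
      rw [h1, norm_smul, norm_pow]
      gcongr
      simp only [norm_mul, Complex.norm_real, Complex.norm_I, Complex.norm_ofNat, Real.norm_eq_abs,
        mul_one]
      rw [abs_of_pos Real.pi_pos]
      nlinarith [Real.pi_gt_three]
    rw [abs_div, abs_one, abs_pow, div_mul_eq_mul_div, one_mul, le_div_iff₀ (by positivity),
      mul_comm]
    exact h3.trans (h2.trans hM)
  have hFsum : Summable fun n : ℤ => 𝓕 g (n : ℝ) := by
    refine Summable.of_norm_bounded_eventually (hsum.mul_right (B k * ∫ t, decayWeight s t)) ?_
    filter_upwards [(Set.finite_singleton (0 : ℤ)).compl_mem_cofinite] with n hn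
    exact hF n hn
  have hP := Real.tsum_eq_tsum_fourier_of_rpow_decay_of_summable hg.continuous hs hO hFsum 0
  have h0 : 𝓕 g ((0 : ℤ) : ℝ) = ∫ t, g t := by
    simp [Real.fourier_eq]
  simp only [zero_add, QuotientAddGroup.mk_zero, fourier_eval_zero, mul_one] at hP
  rw [hP, hFsum.tsum_eq_add_tsum_ite 0, h0, add_sub_cancel_left]
  have hM0 : 0 ≤ B k * ∫ t, decayWeight s t := le_trans (by positivity) hM
  refine tsum_of_norm_bounded (hsum.hasSum.mul_right _) fun n => ?_
  split_ifs with hn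
  · rw [norm_zero]; positivity
  · exact hF n hn

/-- Derivatives along a line in a direction given by a contraction are bounded by the full
derivative. -/
lemma norm_iteratedDeriv_comp_le {E F : Type*} [NormedAddCommGroup E] [NormedSpace ℝ E]
    [NormedAddCommGroup F] [NormedSpace ℝ F] {h : E → F} {j : ℕ} (hh : ContDiff ℝ j h)
    (L : ℝ →L[ℝ] E) (hL : ‖L‖ ≤ 1) (p : E) (t : ℝ) :
    ‖iteratedDeriv j (fun t => h (p + L t)) t‖ ≤ ‖iteratedFDeriv ℝ j h (p + L t)‖ := by
  have hp : ContDiff ℝ j fun z => h (p + z) := hh.comp (contDiff_const.add contDiff_id)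
  rw [← norm_iteratedFDeriv_eq_norm_iteratedDeriv]
  have h1 := L.iteratedFDeriv_comp_right hp t (i := j) le_rfl
  rw [show (fun t => h (p + L t)) = (fun z => h (p + z)) ∘ L from rfl, h1,
    iteratedFDeriv_comp_add_left]
  refine (ContinuousMultilinearMap.norm_compContinuousLinearMap_le _ _).trans ?_
  refine mul_le_of_le_one_right (norm_nonneg _) ?_
  exact Finset.prod_le_one (fun _ _ => norm_nonneg _) fun _ _ => hL

/-- If a function on the plane and its derivatives up to order `k ≥ 2` are dominated by a product
of weights, its sum over `ℤ²` differs from its integral by at most a constant times the bound on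
the `k`-th derivative. -/
lemma norm_tsum_int_prod_sub_integral_le {k : ℕ} (hk : 2 ≤ k) {s : ℝ} (hs : 1 < s)
    {h : ℝ × ℝ → ℂ} (hh : ContDiff ℝ k h) {A : ℕ → ℝ}
    (hA : ∀ j ≤ k, ∀ x y, ‖iteratedFDeriv ℝ j h (x, y)‖ ≤
      A j * (decayWeight s x * decayWeight s y)) :
    ‖(∑' l : ℤ × ℤ, h (l.1, l.2)) - ∫ z, h z‖ ≤
      (∑' n : ℤ, |1 / (n : ℝ) ^ k|) * (∫ t, decayWeight s t) *
        ((∑' n : ℤ, decayWeight s n) + ∫ t, decayWeight s t) * A k := by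
  have hw := decayWeight.integrable hs
  have hws := decayWeight.summable_int hs
  have hh0 (x y : ℝ) : ‖h (x, y)‖ ≤ A 0 * (decayWeight s x * decayWeight s y) := by
    simpa using hA 0 zero_le x y
  have hA0 : 0 ≤ A 0 := by
    have := (norm_nonneg _).trans (hh0 0 0)
    simpa [decayWeight] using this
  set S := ∑' n : ℤ, |1 / (n : ℝ) ^ k|
  set I := ∫ t, decayWeight s t
  have hslice₂ (x : ℝ) : ‖(∑' n : ℤ, h (x, n)) - ∫ y, h (x, y)‖ ≤
      S * I * A k * decayWeight s x := by
    have hc : ContDiff ℝ k fun y => h (x, y) := hh.comp (contDiff_const.prodMk contDiff_id)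
    refine (norm_tsum_int_sub_integral_le hk hs hc (B := fun j => A j * decayWeight s x)
      fun j hj y => ?_).trans_eq (by ring)
    have := norm_iteratedDeriv_comp_le (hh.of_le (mod_cast hj)) (.inr ℝ ℝ ℝ)
      (ContinuousLinearMap.norm_inr_le_one ℝ ℝ ℝ) (x, 0) y
    simp only [ContinuousLinearMap.inr_apply, Prod.mk_add_mk, add_zero, zero_add] at this
    exact this.trans ((hA j hj x y).trans_eq (by ring))
  have hslice₁ (y : ℝ) : ‖(∑' n : ℤ, h (n, y)) - ∫ x, h (x, y)‖ ≤
      S * I * A k * decayWeight s y := by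
    have hc : ContDiff ℝ k fun x => h (x, y) := hh.comp (contDiff_id.prodMk contDiff_const)
    refine (norm_tsum_int_sub_integral_le hk hs hc (B := fun j => A j * decayWeight s y)
      fun j hj x => ?_).trans_eq (by ring)
    have := norm_iteratedDeriv_comp_le (hh.of_le (mod_cast hj)) (.inl ℝ ℝ ℝ)
      (ContinuousLinearMap.norm_inl_le_one ℝ ℝ ℝ) (0, y) x
    simp only [ContinuousLinearMap.inl_apply, Prod.mk_add_mk, add_zero, zero_add] at this
    exact this.trans ((hA j hj x y).trans_eq (by ring))
  have hsum : Summable fun l : ℤ × ℤ => h (l.1, l.2) :=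
    .of_norm_bounded ((hws.mul_of_nonneg hws (fun n => decayWeight.nonneg s n)
      fun n => decayWeight.nonneg s n).mul_left (A 0)) fun l => hh0 _ _
  have hint : Integrable h (volume.prod volume) :=
    ((hw.mul_prod hw).const_mul (A 0)).mono' hh.continuous.aestronglyMeasurable
      (.of_forall fun z => hh0 z.1 z.2)
  have hline (n : ℤ) : Integrable fun y => h (n, y) :=
    ((hw.const_mul (decayWeight s n)).const_mul (A 0)).mono'
      (hh.continuous.comp (by fun_prop)).aestronglyMeasurable (.of_forall fun y => hh0 _ _)
  have hlineNorm (n : ℤ) : ∫ y, ‖h (n, y)‖ ≤ A 0 * I * decayWeight s n := by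
    refine (integral_mono (hline n).norm ((hw.const_mul (decayWeight s n)).const_mul (A 0))
      fun y => hh0 _ _).trans_eq ?_
    rw [integral_const_mul, integral_const_mul]; ring
  have hlineSum : Summable fun n : ℤ => ∫ y, ‖h (n, y)‖ :=
    .of_nonneg_of_le (fun n => by positivity) hlineNorm (hws.mul_left _)
  have hexch : HasSum (fun n : ℤ => ∫ y, h (n, y)) (∫ y, ∑' n : ℤ, h (n, y)) :=
    hasSum_integral_of_summable_integral_norm hline hlineSum
  have hbound (n : ℤ) (y : ℝ) : ‖h (n, y)‖ ≤ A 0 * decayWeight s n := by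
    refine (hh0 n y).trans ?_
    gcongr
    exact mul_le_of_le_one_right (decayWeight.nonneg s n) (decayWeight.le_one hs y)
  have hcont : Continuous fun y => ∑' n : ℤ, h (n, y) :=
    continuous_tsum (fun n => hh.continuous.comp (by fun_prop)) (hws.mul_left (A 0)) hbound
  have hintSum : Integrable fun y => ∑' n : ℤ, h (n, y) := by
    refine (hw.const_mul (A 0 * ∑' n : ℤ, decayWeight s n)).mono' hcont.aestronglyMeasurable
      (.of_forall fun y => ?_)
    refine tsum_of_norm_bounded ((hws.hasSum.mul_left (A 0)).mul_right (decayWeight s y))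
      fun n => (hh0 _ _).trans_eq (by ring)
  have hrows : ‖∑' n : ℤ, ((∑' m : ℤ, h (n, m)) - ∫ y, h (n, y))‖ ≤
      S * I * A k * ∑' n : ℤ, decayWeight s n :=
    tsum_of_norm_bounded (hws.hasSum.mul_left _) fun n => hslice₂ n
  have hcols : ‖∫ y, ((∑' n : ℤ, h (n, y)) - ∫ x, h (x, y))‖ ≤ S * I * A k * I := by
    refine (norm_integral_le_of_norm_le (hw.const_mul (S * I * A k))
      (.of_forall hslice₁)).trans_eq ?_
    rw [integral_const_mul]
  have hsplit : (∑' l : ℤ × ℤ, h (l.1, l.2)) - ∫ z, h z =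
      (∑' n : ℤ, ((∑' m : ℤ, h (n, m)) - ∫ y, h (n, y))) +
        ∫ y, ((∑' n : ℤ, h (n, y)) - ∫ x, h (x, y)) := by
    rw [hsum.prod.tsum_sub hexch.summable, hexch.tsum_eq,
      integral_sub hintSum hint.integral_prod_right, hsum.tsum_prod, Measure.volume_eq_prod,
      integral_prod_symm h hint]
    ring
  rw [hsplit]
  refine (norm_add_le _ _).trans ((add_le_add hrows hcols).trans_eq (by ring))

/-- A power of order `m - k`, `m < -2`, of `1 + a‖(x, y)‖ + r` is dominated by a product of
one-dimensional weights and `r ^ (-k)`. -/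
lemma one_add_norm_add_rpow_le {a m : ℝ} (ha : 0 < a) (hm : m < -2) (k : ℕ) (x y : ℝ) {r : ℝ}
    (hr : 1 ≤ r) :
    (1 + ‖a • (x, y)‖ + r) ^ (m - (k : ℝ)) ≤
      (min 1 a) ^ m * (r ^ k)⁻¹ * (decayWeight (-m / 2) x * decayWeight (-m / 2) y) := by
  have hc : 0 < min 1 a := by positivity
  have key (t : ℝ) (ht : ‖t‖ ≤ ‖(x, y)‖) :
      (1 + ‖a • (x, y)‖ + r) ^ (m / 2) ≤ (min 1 a) ^ (m / 2) * decayWeight (-m / 2) t := by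
    rw [decayWeight, neg_div, neg_neg, ← Real.mul_rpow hc.le (by positivity)]
    refine Real.rpow_le_rpow_of_nonpos (by positivity) ?_ (by linarith)
    rw [norm_smul, Real.norm_of_nonneg ha.le]
    have h1 : min 1 a * ‖t‖ ≤ a * ‖(x, y)‖ := by
      gcongr
      exact min_le_right _ _
    linarith [min_le_left 1 a]
  have hT : 0 < 1 + ‖a • (x, y)‖ + r := by positivity
  have hk : (1 + ‖a • (x, y)‖ + r) ^ (-(k : ℝ)) ≤ (r ^ k)⁻¹ := by
    rw [Real.rpow_neg hT.le, Real.rpow_natCast]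
    gcongr
    linarith [norm_nonneg (a • (x, y))]
  calc (1 + ‖a • (x, y)‖ + r) ^ (m - (k : ℝ))
      = (1 + ‖a • (x, y)‖ + r) ^ (m / 2) * (1 + ‖a • (x, y)‖ + r) ^ (m / 2) *
          (1 + ‖a • (x, y)‖ + r) ^ (-(k : ℝ)) := by
        rw [← Real.rpow_add hT, ← Real.rpow_add hT]; congr 1; ring
    _ ≤ ((min 1 a) ^ (m / 2) * decayWeight (-m / 2) x) *
          ((min 1 a) ^ (m / 2) * decayWeight (-m / 2) y) * (r ^ k)⁻¹ := by
        have := decayWeight.nonneg (-m / 2) x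
        have := decayWeight.nonneg (-m / 2) y
        gcongr
        · exact key x (le_max_left _ _)
        · exact key y (le_max_right _ _)
    _ = ((min 1 a) ^ (m / 2) * (min 1 a) ^ (m / 2)) * (r ^ k)⁻¹ *
          (decayWeight (-m / 2) x * decayWeight (-m / 2) y) := by ring
    _ = _ := by rw [← Real.rpow_add hc, add_halves]

/-- The lattice sum of a parameter-dependent symbol of order `m < −2` on `ℝ²`
equals `a^{−2}` times its integral, up to an `O(λ^{−∞})` error: if for each
`λ ≥ 1` the function `ξ ↦ f(ξ,λ)` is smooth and all its derivatives of order `k`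
are bounded by `C_k (1+‖ξ‖+λ)^{m−k}`, then for every `N` there is `C > 0` with
`‖Σ_{ℓ∈ℤ²} f(aℓ,λ) − a^{−2} ∫_{ℝ²} f(ξ,λ) dξ‖ ≤ C λ^{−N}` for all `λ ≥ 1`. -/
theorem lattice_sum_vs_integral (m : ℝ) (hm : m < -2) (a : ℝ) (ha : 0 < a)
    (f : ℝ × ℝ → ℝ → ℂ)
    (hsmooth : ∀ lam : ℝ, 1 ≤ lam → ContDiff ℝ (⊤ : ℕ∞) (fun ξ => f ξ lam))
    (hest : ∀ k : ℕ, ∃ C > 0, ∀ (ξ : ℝ × ℝ) (lam : ℝ), 1 ≤ lam →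
      ‖iteratedFDeriv ℝ k (fun ζ => f ζ lam) ξ‖ ≤ C * (1 + ‖ξ‖ + lam) ^ (m - (k : ℝ))) :
    ∀ N : ℕ, ∃ C > 0, ∀ lam : ℝ, 1 ≤ lam →
      ‖(∑' ℓ : ℤ × ℤ, f (a * (ℓ.1 : ℝ), a * (ℓ.2 : ℝ)) lam)
          - ((a : ℂ) ^ 2)⁻¹ * ∫ ξ : ℝ × ℝ, f ξ lam‖ ≤ C / lam ^ N := by
  intro N
  have hs : 1 < -m / 2 := by linarith
  choose C hC0 hC using hest
  set D := (∑' n : ℤ, |1 / (n : ℝ) ^ (N + 2)|) * (∫ t, decayWeight (-m / 2) t) *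
    ((∑' n : ℤ, decayWeight (-m / 2) n) + ∫ t, decayWeight (-m / 2) t)
  have hD : 0 ≤ D := by
    have hw := decayWeight.nonneg (-m / 2)
    have h1 : 0 ≤ ∫ t, decayWeight (-m / 2) t := integral_nonneg hw
    have h2 : 0 ≤ ∑' n : ℤ, decayWeight (-m / 2) n := tsum_nonneg fun n => hw n
    positivity
  set E := a ^ (N + 2) * C (N + 2) * (min 1 a) ^ m
  have hE : 0 ≤ E := by
    have := hC0 (N + 2)
    positivity
  refine ⟨D * E + 1, by positivity, fun lam hlam => ?_⟩
  have hlam0 : 0 < lam := by linarith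
  have hf (j : ℕ) : ContDiff ℝ j fun ξ => f ξ lam := (hsmooth lam hlam).of_le (mod_cast le_top)
  have hscale : ContDiff ℝ (N + 2 : ℕ) fun z : ℝ × ℝ => f (a • z) lam :=
    (hf _).comp (contDiff_const_smul a)
  have hbound (j : ℕ) (_ : j ≤ N + 2) (x y : ℝ) :
      ‖iteratedFDeriv ℝ j (fun z : ℝ × ℝ => f (a • z) lam) (x, y)‖ ≤
        (a ^ j * C j * (min 1 a) ^ m * (lam ^ j)⁻¹) *
          (decayWeight (-m / 2) x * decayWeight (-m / 2) y) := by
    rw [iteratedFDeriv_comp_const_smul a (hf j), norm_smul, norm_pow, Real.norm_of_nonneg ha.le]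
    have h1 := hC j (a • (x, y)) lam hlam
    have h2 := one_add_norm_add_rpow_le ha hm j x y hlam
    calc _ ≤ a ^ j * (C j * _) :=
          mul_le_mul_of_nonneg_left (h1.trans (mul_le_mul_of_nonneg_left h2 (hC0 j).le))
            (by positivity)
      _ = _ := by ring
  have hmain := norm_tsum_int_prod_sub_integral_le (Nat.le_add_left 2 N) hs hscale hbound
  have hintegral : ∫ z : ℝ × ℝ, f (a • z) lam = ((a : ℂ) ^ 2)⁻¹ * ∫ ξ : ℝ × ℝ, f ξ lam := by
    rw [Measure.integral_comp_smul volume (fun ξ => f ξ lam) a]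
    simp [Complex.real_smul, abs_of_pos ha]
  rw [hintegral] at hmain
  simp only [Prod.smul_mk, smul_eq_mul] at hmain
  refine hmain.trans ?_
  have hpow : (lam ^ (N + 2))⁻¹ ≤ (lam ^ N)⁻¹ := by
    gcongr
    omega
  calc D * (E * (lam ^ (N + 2))⁻¹) = D * E * (lam ^ (N + 2))⁻¹ := by ring
    _ ≤ (D * E + 1) * (lam ^ N)⁻¹ := by gcongr; linarith
    _ = (D * E + 1) / lam ^ N := (div_eq_mul_inv _ _).symm
end

section
/- Let s, t be nonzero real numbers with s + t ≠ 0, and set u = e^s, v = e^t. Then the following identity between a hyperbolic-function expression and a rational-logarithmic expression holds: e^{−(s+t)/2} · [ t(s+t)cosh(s) − s(s+t)cosh(t) + (s − t)(s + t + sinh(s) + sinh(t) − sinh(s+t)) ] / [ s·t·(s+t)·sinh(s/2)·sinh(t/2)·sinh²((s+t)/2) ] = 8 · [ t²(u−1)²v − s²u(v−1)² + s·t·(u−v)(uv−1) + (t−s)(u−1)(v−1)(uv−1) ] / [ s·t·(s+t)·(u−1)(v−1)(uv−1)² ]. (All denominators are nonzero since s, t, s+t ≠ 0 implies u, v, uv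 ≠ 1 and the hyperbolic sines are nonzero.) -/
theorem sinh_half_eq (x : ℝ) :
    Real.sinh (x / 2) = (Real.exp x - 1) / (2 * Real.exp (x / 2)) := by
  have hx : Real.exp x = Real.exp (x / 2) * Real.exp (x / 2) := by
    rw [← Real.exp_add, add_halves]
  have h := Real.exp_ne_zero (x / 2)
  rw [Real.sinh_eq, Real.exp_neg, hx]
  field_simp

/-- The identity between the hyperbolic and the rational-logarithmic forms of the
adjusted Connes–Moscovici two-variable function `H₀^CM`: for `s, t, s+t ≠ 0` and
`u = e^s`, `v = e^t`,
`e^{−(s+t)/2} [t(s+t)cosh s − s(s+t)cosh t + (s−t)(s+t+sinh s+sinh t−sinh(s+t))]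
  / [st(s+t) sinh(s/2) sinh(t/2) sinh²((s+t)/2)]
= 8 [t²(u−1)²v − s²u(v−1)² + st(u−v)(uv−1) + (t−s)(u−1)(v−1)(uv−1)]
  / [st(s+t)(u−1)(v−1)(uv−1)²]`. -/
theorem H0CM_hyperbolic_eq_rational_log (s t : ℝ) (hs : s ≠ 0) (ht : t ≠ 0)
    (hst : s + t ≠ 0) :
    let u := Real.exp s
    let v := Real.exp t
    Real.exp (-(s + t) / 2) *
        (t * (s + t) * Real.cosh s - s * (s + t) * Real.cosh t
          + (s - t) * (s + t + Real.sinh s + Real.sinh t - Real.sinh (s + t))) /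
      (s * t * (s + t) * Real.sinh (s / 2) * Real.sinh (t / 2)
        * Real.sinh ((s + t) / 2) ^ 2)
    = 8 * (t ^ 2 * (u - 1) ^ 2 * v - s ^ 2 * u * (v - 1) ^ 2
          + s * t * (u - v) * (u * v - 1)
          + (t - s) * (u - 1) * (v - 1) * (u * v - 1)) /
      (s * t * (s + t) * (u - 1) * (v - 1) * (u * v - 1) ^ 2) := by
  intro u v
  have hu : u ≠ 0 := Real.exp_ne_zero s
  have hv : v ≠ 0 := Real.exp_ne_zero t
  have hu1 : u - 1 ≠ 0 := sub_ne_zero.mpr (by simpa [u] using hs)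
  have hv1 : v - 1 ≠ 0 := sub_ne_zero.mpr (by simpa [v] using ht)
  have huv : Real.exp (s + t) = u * v := Real.exp_add s t
  have huv1 : u * v - 1 ≠ 0 := by
    rw [← huv]
    exact sub_ne_zero.mpr (by simpa using hst)
  have hden : Real.exp ((s + t) / 2) *
      (Real.sinh (s / 2) * Real.sinh (t / 2) * Real.sinh ((s + t) / 2) ^ 2)
      = (u - 1) * (v - 1) * (u * v - 1) ^ 2 / (16 * (u * v)) := by
    have hhalf : Real.exp ((s + t) / 2) = Real.exp (s / 2) * Real.exp (t / 2) := by
      rw [add_div, Real.exp_add]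
    rw [sinh_half_eq s, sinh_half_eq t, sinh_half_eq (s + t), huv, hhalf]
    have hsq : (Real.exp (s / 2) * Real.exp (t / 2)) ^ 2 = u * v := by
      rw [← hhalf, ← huv, ← Real.exp_nat_mul]
      congr 1
      push_cast
      ring
    rw [← hsq]
    have h₁ := Real.exp_ne_zero (s / 2)
    have h₂ := Real.exp_ne_zero (t / 2)
    rw [show Real.exp s = u from rfl, show Real.exp t = v from rfl]
    field_simp
    ring
  have hnum : t * (s + t) * Real.cosh s - s * (s + t) * Real.cosh t
      + (s - t) * (s + t + Real.sinh s + Real.sinh t - Real.sinh (s + t))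
      = (t ^ 2 * (u - 1) ^ 2 * v - s ^ 2 * u * (v - 1) ^ 2
          + s * t * (u - v) * (u * v - 1)
          + (t - s) * (u - 1) * (v - 1) * (u * v - 1)) / (2 * (u * v)) := by
    simp only [Real.cosh_eq, Real.sinh_eq, Real.exp_neg, huv]
    change t * (s + t) * ((u + u⁻¹) / 2) - s * (s + t) * ((v + v⁻¹) / 2)
      + (s - t) * (s + t + (u - u⁻¹) / 2 + (v - v⁻¹) / 2 - (u * v - (u * v)⁻¹) / 2) = _
    field_simp
    ring
  rw [hnum, neg_div, Real.exp_neg, inv_mul_eq_div, div_div]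
  rw [show Real.exp ((s + t) / 2) *
      (s * t * (s + t) * Real.sinh (s / 2) * Real.sinh (t / 2) * Real.sinh ((s + t) / 2) ^ 2)
      = s * t * (s + t) * (Real.exp ((s + t) / 2) *
        (Real.sinh (s / 2) * Real.sinh (t / 2) * Real.sinh ((s + t) / 2) ^ 2)) by ring, hden]
  field_simp
  ring
end
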